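/- Let λ > 0 be such that λ·∫_{ℝ²} v² ≤ ∫_{ℝ²} |∇v|² for every Lipschitz function v : ℝ² → ℝ vanishing on ℝ² ∖ Ω (a Poincaré constant for Ω). Then for every p > 1 and every nodal solution u_p of (𝒫_p) one has (max_Ω u_p)^{p−1} ≥ λ and (−min_Ω u_p)^{p−1} ≥ λ. -/

import Mathlib

open MeasureTheory Real Set Filter Topology Metric

noncomputable section

/-- The Euclidean plane. -/
abbrev R2 : Type := EuclideanSpace ℝ (Fin 2)

/-- The Laplacian: sum of the two pure second directional derivatives. -/
def lap (u : R2 → ℝ) (x : R2) : ℝ :=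
  ∑ i : Fin 2,
    fderiv ℝ (fun y => fderiv ℝ u y (EuclideanSpace.single i 1)) x (EuclideanSpace.single i 1)

/-- Each point of ∂Ω has a neighborhood in which ∂Ω is the graph of a C^∞ function
(in suitable Euclidean coordinates). -/
def SmoothBoundary (Ω : Set R2) : Prop :=
  ∀ x ∈ frontier Ω, ∃ V : Set R2, IsOpen V ∧ x ∈ V ∧
    ∃ (e : R2 ≃ᵢ R2) (g : ℝ → ℝ), ContDiff ℝ (⊤ : ℕ∞) g ∧
      frontier Ω ∩ V = {y | y ∈ V ∧ e y 1 = g (e y 0)}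

/-- A (classical) solution of the Lane–Emden problem `(𝒫_p)` on Ω. -/
def IsSolution (Ω : Set R2) (p : ℝ) (u : R2 → ℝ) : Prop :=
  ContDiffOn ℝ 2 u Ω ∧ ContDiffOn ℝ 1 u (closure Ω) ∧
  (∀ x ∈ Ω, -lap u x = |u x| ^ (p - 1) * u x) ∧
  (∀ x ∈ frontier Ω, u x = 0)

/-- A nodal (sign-changing) function on Ω. -/
def IsNodal (Ω : Set R2) (u : R2 → ℝ) : Prop :=
  (∃ x ∈ Ω, 0 < u x) ∧ ∃ x ∈ Ω, u x < 0

/-- The energy functional E_p. -/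
def energy (Ω : Set R2) (p : ℝ) (u : R2 → ℝ) : ℝ :=
  (1 / 2) * ∫ x in Ω, ‖gradient u x‖ ^ 2 - (1 / (p + 1)) * ∫ x in Ω, |u x| ^ (p + 1)

/-- Condition (A): p·∫_Ω |∇u_p|² → 16πe. -/
def CondA (Ω : Set R2) (u : ℝ → R2 → ℝ) : Prop :=
  Tendsto (fun p : ℝ => p * ∫ x in Ω, ‖gradient (u p) x‖ ^ 2) atTop
    (𝓝 (16 * π * Real.exp 1))

/-- Condition (B): p·(u_p(x_p⁺) + u_p(x_p⁻)) → K for some K ≥ 0. -/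
def CondB (u : ℝ → R2 → ℝ) (xp xm : ℝ → R2) : Prop :=
  ∃ K : ℝ, 0 ≤ K ∧ Tendsto (fun p : ℝ => p * (u p (xp p) + u p (xm p))) atTop (𝓝 K)

/-- ε_p := (p·u_p(x_p⁺)^{p−1})^{−1/2}. -/
def eps (u : ℝ → R2 → ℝ) (xp : ℝ → R2) (p : ℝ) : ℝ :=
  1 / Real.sqrt (p * u p (xp p) ^ (p - 1))

/-- The rescaling z_p of u_p around x_p⁺. -/
def zp (u : ℝ → R2 → ℝ) (xp : ℝ → R2) (p : ℝ) (x : R2) : ℝ :=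
  (p / u p (xp p)) * (u p (eps u xp p • x + xp p) - u p (xp p))

/-- The rescaling z_p⁻ of u_p around x_p⁻ (with the scale ε_p of the maximum). -/
def zm (u : ℝ → R2 → ℝ) (xp xm : ℝ → R2) (p : ℝ) (x : R2) : ℝ :=
  (p / u p (xp p)) * (-u p (eps u xp p • x + xm p) - u p (xp p))

/-- Convergence in C²_loc(ℝ²) of a family of functions f_i defined on sets D_i:
every compact set K is eventually contained in D_i, and on K all derivatives up to
order 2 converge uniformly. -/
def TendstoC2loc {ι : Type} (l : Filter ι) (D : ι → Set R2) (f : ι → R2 → ℝ)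
    (g : R2 → ℝ) : Prop :=
  ∀ K : Set R2, IsCompact K →
    (∀ᶠ i in l, K ⊆ D i) ∧
    ∀ n : ℕ, n ≤ 2 →
      TendstoUniformlyOn (fun i x => iteratedFDeriv ℝ n (f i) x)
        (fun x => iteratedFDeriv ℝ n g x) l K

/-- The standard bubble U(x) = −2 log(1 + |x|²/8). -/
def stdBubble (x : R2) : ℝ := -2 * Real.log (1 + ‖x‖ ^ 2 / 8)

/-- The bubble U_μ(x) = log(μ/(1 + μ|x|²/8)²). -/
def bubble (μ : ℝ) (x : R2) : ℝ := Real.log (μ / (1 + μ * ‖x‖ ^ 2 / 8) ^ 2)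

/-- A C^∞ function compactly supported in S. -/
def CcSmoothIn (S : Set R2) (v : R2 → ℝ) : Prop :=
  ContDiff ℝ (⊤ : ℕ∞) v ∧ HasCompactSupport v ∧ tsupport v ⊆ S

/-- The quadratic form of the linearized operator at u. -/
def Qform (p : ℝ) (u v : R2 → ℝ) : ℝ :=
  ∫ x, (‖gradient v x‖ ^ 2 - p * |u x| ^ (p - 1) * v x ^ 2)

/-- Morse index one hypothesis (M): for p large, the quadratic form of the linearized
operator is negative somewhere on C_c^∞ of the positive nodal domain, but is not
negative definite on any 2-dimensional subspace. -/
def MorseOne (Ω : Set R2) (u : ℝ → R2 → ℝ) : Prop :=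
  ∀ᶠ p : ℝ in atTop,
    (∃ v : R2 → ℝ, CcSmoothIn {x ∈ Ω | 0 < u p x} v ∧ Qform p (u p) v < 0) ∧
    ¬ ∃ v w : R2 → ℝ, CcSmoothIn {x ∈ Ω | 0 < u p x} v ∧
        CcSmoothIn {x ∈ Ω | 0 < u p x} w ∧
        LinearIndependent ℝ ![v, w] ∧
        ∀ a b : ℝ, ¬(a = 0 ∧ b = 0) →
          Qform p (u p) (fun x => a * v x + b * w x) < 0

lemma gradient_apply_eq_fderiv_single (f : R2 → ℝ) (x : R2) (i : Fin 2) :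
    gradient f x i = fderiv ℝ f x (EuclideanSpace.single i 1) := by
  have h := InnerProductSpace.toDual_symm_apply (𝕜 := ℝ) (x := EuclideanSpace.single i (1 : ℝ))
    (y := fderiv ℝ f x)
  rw [← h, EuclideanSpace.inner_single_right]
  simp [gradient]

lemma norm_gradient_sq_eq_sum (f : R2 → ℝ) (x : R2) :
    ‖gradient f x‖ ^ 2 = ∑ i : Fin 2, fderiv ℝ f x (EuclideanSpace.single i 1) ^ 2 := by
  simp [EuclideanSpace.norm_sq_eq, gradient_apply_eq_fderiv_single]

lemma contDiff_one_fderiv_apply {w : R2 → ℝ} (hw : ContDiff ℝ 2 w) (e : R2) :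
    ContDiff ℝ 1 (fun y => fderiv ℝ w y e) :=
  (hw.fderiv_right (m := 1) (by norm_num)).clm_apply contDiff_const

lemma continuous_lap {w : R2 → ℝ} (hw : ContDiff ℝ 2 w) : Continuous (lap w) :=
  continuous_finsetSum _ fun _ _ =>
    ((contDiff_one_fderiv_apply hw _).continuous_fderiv one_ne_zero).clm_apply continuous_const

/-- The lower truncation `(w - ε)⁺` of a Lipschitz function is Lipschitz. -/
lemma LipschitzWith.max_sub_zero {w : R2 → ℝ} {C : NNReal} (h : LipschitzWith C w) (ε : ℝ) :
    LipschitzWith C (fun x => max (w x - ε) 0) := by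
  have := (h.sub (LipschitzWith.const ε)).max_const 0
  simpa using this

/-- Green's identity for the truncation `(w - ε)⁺` of a `C²` function with compact support. -/
lemma integral_norm_gradient_max_sub_zero_sq {w : R2 → ℝ} (hw : ContDiff ℝ 2 w)
    (hc : HasCompactSupport w) (ε : ℝ) :
    ∫ x, ‖gradient (fun x => max (w x - ε) 0) x‖ ^ 2 = ∫ x, max (w x - ε) 0 * -lap w x := by
  set v : R2 → ℝ := fun x => max (w x - ε) 0 with hv
  obtain ⟨C, hC⟩ := ContDiff.lipschitzWith_of_hasCompactSupport hc hw two_ne_zero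
  have hvL : LipschitzWith C v := hC.max_sub_zero ε
  let e : Fin 2 → R2 := fun i => EuclideanSpace.single i 1
  have hg : ∀ i, ContDiff ℝ 1 (fun y => fderiv ℝ w y (e i)) :=
    fun i => contDiff_one_fderiv_apply hw _
  have hgc : ∀ i, HasCompactSupport (fun y => fderiv ℝ w y (e i)) :=
    fun i => hc.fderiv_apply (𝕜 := ℝ) (e i)
  have hpt : ∀ x, ‖gradient v x‖ ^ 2 =
      ∑ i, lineDeriv ℝ v x (e i) * fderiv ℝ w x (e i) := by
    intro x
    rw [norm_gradient_sq_eq_sum]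
    refine Finset.sum_congr rfl fun i _ => ?_
    rcases le_or_gt (w x) ε with hx | hx
    · have hmin : IsLocalMin v x := Eventually.of_forall fun y => by
        simp only [hv]
        rw [max_eq_right (by linarith : w x - ε ≤ 0)]
        exact le_max_right _ _
      rw [hmin.fderiv_eq_zero, hmin.lineDeriv_eq_zero]
      simp
    · have hev : v =ᶠ[𝓝 x] fun y => w y - ε := by
        filter_upwards [hw.continuous.continuousAt.eventually (lt_mem_nhds hx)] with y hy
        exact max_eq_left (by linarith)
      have hd : fderiv ℝ v x = fderiv ℝ w x := by
        rw [hev.fderiv_eq, fderiv_sub_const]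
      have hdv : DifferentiableAt ℝ v x :=
        (((hw.differentiable two_ne_zero) x).sub_const ε).congr_of_eventuallyEq hev
      rw [hdv.lineDeriv_eq_fderiv, hd, sq]
  have hint : ∀ i, Integrable (fun x => lineDeriv ℝ v x (e i) * fderiv ℝ w x (e i)) := by
    intro i
    have h := (hvL.locallyIntegrable_lineDeriv (μ := volume)
      (e i)).integrable_smul_left_of_hasCompactSupport (hg i).continuous (hgc i)
    exact h.congr (Eventually.of_forall fun x => by simp [mul_comm])
  have hgd : ∀ i, Continuous fun x => fderiv ℝ (fun y => fderiv ℝ w y (e i)) x (e i) :=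
    fun i => ((hg i).continuous_fderiv one_ne_zero).clm_apply continuous_const
  have hint' : ∀ i, Integrable
      (fun x => v x * -fderiv ℝ (fun y => fderiv ℝ w y (e i)) x (e i)) := fun i =>
    (hvL.continuous.mul (hgd i).neg).integrable_of_hasCompactSupport
      (((hgc i).fderiv_apply (𝕜 := ℝ) (e i)).neg.mul_left)
  calc ∫ x, ‖gradient v x‖ ^ 2
      = ∑ i, ∫ x, lineDeriv ℝ v x (e i) * fderiv ℝ w x (e i) := by
        simp_rw [hpt]
        exact integral_finsetSum _ fun i _ => hint i
    _ = ∑ i, ∫ x, v x * -fderiv ℝ (fun y => fderiv ℝ w y (e i)) x (e i) := by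
        refine Finset.sum_congr rfl fun i _ => ?_
        obtain ⟨D, hD⟩ := ContDiff.lipschitzWith_of_hasCompactSupport (hgc i) (hg i) one_ne_zero
        rw [LipschitzWith.integral_lineDeriv_mul_eq hvL hD (hgc i)]
        refine integral_congr_ae (Eventually.of_forall fun x => ?_)
        simp only
        rw [((hg i).differentiable one_ne_zero x).lineDeriv_eq_fderiv, map_neg, mul_comm]
    _ = ∫ x, v x * -lap w x := by
        rw [← integral_finsetSum _ fun i _ => hint' i]
        refine integral_congr_ae (Eventually.of_forall fun x => ?_)
        simp only [lap, e, Fin.sum_univ_two]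
        ring

/-- A continuous function on `closure Ω`, of class `C²` in the bounded open set `Ω` and vanishing
on the boundary, agrees near each point where it exceeds `ε` with a `C²` function with compact
support in `Ω` having the same truncation at level `ε`. -/
lemma exists_contDiff_eq_above {Ω : Set R2} (hop : IsOpen Ω) (hbdd : Bornology.IsBounded Ω)
    {u : R2 → ℝ} (hu : ContDiffOn ℝ 2 u Ω) (hcont : ContinuousOn u (closure Ω))
    (hbd : ∀ x ∈ frontier Ω, u x = 0) {ε : ℝ} (hε : 0 < ε) :
    ∃ w : R2 → ℝ, ContDiff ℝ 2 w ∧ HasCompactSupport w ∧ (∀ x ∉ Ω, w x = 0) ∧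
      (∀ x ∈ Ω, max (w x - ε) 0 = max (u x - ε) 0) ∧
      ∀ x, ε < w x → x ∈ Ω ∧ w =ᶠ[𝓝 x] u := by
  let g : R2 → ℝ := fun x => u x * Real.smoothTransition (u x * (4 / ε) - 1)
  have hg0 : ∀ x, u x ≤ ε / 4 → g x = 0 := by
    intro x hx
    have : u x * (4 / ε) ≤ 1 := by
      calc u x * (4 / ε) ≤ ε / 4 * (4 / ε) := by gcongr
        _ = 1 := by field_simp
    simp [g, Real.smoothTransition.zero_of_nonpos (by linarith : u x * (4 / ε) - 1 ≤ 0)]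
  have hg1 : ∀ x, ε / 2 ≤ u x → g x = u x := by
    intro x hx
    have : 2 ≤ u x * (4 / ε) := by
      calc (2 : ℝ) = ε / 2 * (4 / ε) := by field_simp; norm_num
        _ ≤ u x * (4 / ε) := by gcongr
    simp [g, Real.smoothTransition.one_of_one_le (by linarith : 1 ≤ u x * (4 / ε) - 1)]
  have hgle : ∀ x, u x ≤ ε → g x ≤ ε := by
    intro x hx
    rcases le_total (u x) 0 with h | h
    · rw [hg0 x (by linarith)]
      exact hε.le
    · exact (mul_le_of_le_one_right h (Real.smoothTransition.le_one _)).trans hx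
  let w : R2 → ℝ := Ω.indicator g
  have hwg : ∀ x ∈ Ω, w x = g x := fun x hx => indicator_of_mem hx g
  have hw0 : ∀ x ∉ Ω, w x = 0 := fun x hx => indicator_of_notMem hx g
  let K : Set R2 := closure Ω ∩ u ⁻¹' Ici (ε / 4)
  have hKclosed : IsClosed K := hcont.preimage_isClosed_of_isClosed isClosed_closure isClosed_Ici
  have hKcomp : IsCompact K := hbdd.isCompact_closure.of_isClosed_subset hKclosed inter_subset_left
  have hKΩ : K ⊆ Ω := by
    rintro x ⟨hxc, hx⟩
    by_contra hxΩ
    have h0 := hbd x ⟨hxc, by rwa [hop.interior_eq]⟩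
    have : ε / 4 ≤ u x := hx
    linarith
  have hwK : ∀ x ∉ K, w x = 0 := by
    intro x hx
    by_cases hxΩ : x ∈ Ω
    · rw [hwg x hxΩ]
      refine hg0 x (le_of_not_ge fun h => hx ⟨subset_closure hxΩ, h⟩)
    · exact hw0 x hxΩ
  refine ⟨w, contDiff_iff_contDiffAt.2 fun x => ?_, HasCompactSupport.intro hKcomp hwK, hw0, ?_, ?_⟩
  · by_cases hx : x ∈ K
    · have hux : ContDiffAt ℝ 2 u x := hu.contDiffAt (hop.mem_nhds (hKΩ hx))
      have hgx : ContDiffAt ℝ 2 g x :=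
        hux.mul (Real.smoothTransition.contDiffAt.comp x
          ((hux.mul contDiffAt_const).sub contDiffAt_const))
      refine hgx.congr_of_eventuallyEq ?_
      filter_upwards [hop.mem_nhds (hKΩ hx)] with y hy using hwg y hy
    · refine (contDiffAt_const (c := (0 : ℝ))).congr_of_eventuallyEq ?_
      filter_upwards [hKclosed.isOpen_compl.mem_nhds hx] with y hy using hwK y hy
  · intro x hx
    rw [hwg x hx]
    rcases le_total (u x) ε with h | h
    · rw [max_eq_right (by linarith [hgle x h]), max_eq_right (by linarith)]
    · rw [hg1 x (by linarith)]
  · intro x hx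
    have hxΩ : x ∈ Ω := by
      by_contra h
      rw [hw0 x h] at hx
      linarith
    refine ⟨hxΩ, ?_⟩
    have hux : ε < u x := by
      by_contra! h
      rw [hwg x hxΩ] at hx
      linarith [hgle x h]
    have hca := (hu.continuousOn.continuousAt (hop.mem_nhds hxΩ)).eventually (lt_mem_nhds hux)
    filter_upwards [hca, hop.mem_nhds hxΩ] with y hy hyΩ
    rw [hwg y hyΩ, hg1 y (by linarith)]

lemma lap_congr {u w : R2 → ℝ} {x : R2} (h : w =ᶠ[𝓝 x] u) : lap w x = lap u x := by
  refine Finset.sum_congr rfl fun i _ => ?_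
  have : (fun y => fderiv ℝ w y (EuclideanSpace.single i 1)) =ᶠ[𝓝 x]
      fun y => fderiv ℝ u y (EuclideanSpace.single i 1) :=
    (h.fderiv (𝕜 := ℝ)).mono fun y hy => by simp only [hy]
  rw [this.fderiv_eq]

lemma lap_neg (u : R2 → ℝ) (x : R2) : lap (fun y => -u y) x = -lap u x := by
  simp [lap, fderiv_fun_neg]

/-- The integral inequality obtained by testing the Lane–Emden equation with `(u - ε)⁺`. -/
lemma poincare_mul_integral_sq_le {Ω : Set R2} (hop : IsOpen Ω) (hbdd : Bornology.IsBounded Ω)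
    {lam : ℝ}
    (hpoincare : ∀ v : R2 → ℝ, (∃ L : NNReal, LipschitzWith L v) →
      (∀ x ∉ Ω, v x = 0) → lam * ∫ x, v x ^ 2 ≤ ∫ x, ‖gradient v x‖ ^ 2)
    {p : ℝ} (hp : 1 < p) {u : R2 → ℝ} (hu : ContDiffOn ℝ 2 u Ω)
    (hcont : ContinuousOn u (closure Ω)) (hbd : ∀ x ∈ frontier Ω, u x = 0)
    (heq : ∀ x ∈ Ω, -lap u x = |u x| ^ (p - 1) * u x)
    {M : ℝ} (hM : 0 ≤ M) (huM : ∀ x ∈ Ω, u x ≤ M) {ε : ℝ} (hε : 0 < ε) :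
    ∃ v : R2 → ℝ, Continuous v ∧ HasCompactSupport v ∧ (∀ x ∉ Ω, v x = 0) ∧
      (∀ x ∈ Ω, v x = max (u x - ε) 0) ∧
      lam * ∫ x, v x ^ 2 ≤ M ^ (p - 1) * ((∫ x, v x ^ 2) + ε * (volume.real Ω * M)) := by
  obtain ⟨w, hw, hc, hw0, hwu, hloc⟩ := exists_contDiff_eq_above hop hbdd hu hcont hbd hε
  have hvc : Continuous fun x => max (w x - ε) 0 := by
    have := hw.continuous
    fun_prop
  have hv0 : ∀ x, w x = 0 → max (w x - ε) 0 = 0 := fun x hx => by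
    rw [hx]
    exact max_eq_right (by linarith)
  have hvcs : HasCompactSupport fun x => max (w x - ε) 0 :=
    hc.mono fun x hx h => hx (hv0 x h)
  have hvΩ : ∀ x ∉ Ω, max (w x - ε) 0 = 0 := fun x hx => hv0 x (hw0 x hx)
  refine ⟨_, hvc, hvcs, hvΩ, hwu, ?_⟩
  obtain ⟨C, hC⟩ := ContDiff.lipschitzWith_of_hasCompactSupport hc hw two_ne_zero
  refine (hpoincare _ ⟨C, hC.max_sub_zero ε⟩ hvΩ).trans ?_
  rw [integral_norm_gradient_max_sub_zero_sq hw hc]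
  have hi1 : Integrable fun x => max (w x - ε) 0 :=
    hvc.integrable_of_hasCompactSupport hvcs
  have hi2 : Integrable fun x => max (w x - ε) 0 ^ 2 := by
    simp_rw [sq]
    exact (hvc.mul hvc).integrable_of_hasCompactSupport hvcs.mul_right
  have hi3 : Integrable fun x => max (w x - ε) 0 * -lap w x :=
    (hvc.mul (continuous_lap hw).neg).integrable_of_hasCompactSupport hvcs.mul_right
  have hA : 0 ≤ M ^ (p - 1) := Real.rpow_nonneg hM _
  have hle : ∫ x, max (w x - ε) 0 * -lap w x ≤
      ∫ x, M ^ (p - 1) * (max (w x - ε) 0 ^ 2 + ε * max (w x - ε) 0) := by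
    refine integral_mono hi3 ((hi2.add (hi1.const_mul ε)).const_mul _) fun x => ?_
    rcases le_or_gt (w x) ε with h | h
    · simp [max_eq_right (by linarith : w x - ε ≤ 0)]
    · obtain ⟨hxΩ, hev⟩ := hloc x h
      have hwx : w x = u x := hev.self_of_nhds
      simp only
      rw [max_eq_left (by linarith), lap_congr hev, heq x hxΩ, hwx]
      rw [hwx] at h
      rw [abs_of_pos (hε.trans h)]
      have h1 : u x ^ (p - 1) ≤ M ^ (p - 1) :=
        Real.rpow_le_rpow (hε.trans h).le (huM x hxΩ) (by linarith)
      have h2 : 0 ≤ (u x - ε) * u x := mul_nonneg (by linarith) (by linarith)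
      calc (u x - ε) * (u x ^ (p - 1) * u x) = u x ^ (p - 1) * ((u x - ε) * u x) := by ring
        _ ≤ M ^ (p - 1) * ((u x - ε) * u x) := by gcongr
        _ = M ^ (p - 1) * ((u x - ε) ^ 2 + ε * (u x - ε)) := by ring
  have hv1 : ∫ x, max (w x - ε) 0 ≤ volume.real Ω * M := by
    rw [← setIntegral_eq_integral_of_forall_compl_eq_zero hvΩ]
    calc ∫ x in Ω, max (w x - ε) 0 ≤ ∫ x in Ω, M := by
          refine setIntegral_mono_on hi1.integrableOn
            (integrableOn_const hbdd.measure_lt_top.ne) hop.measurableSet fun x hx => ?_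
          rw [hwu x hx]
          exact max_le (by linarith [huM x hx]) hM
      _ = volume.real Ω * M := by simp
  refine hle.trans ?_
  rw [integral_const_mul, integral_add hi2 (hi1.const_mul ε), integral_const_mul]
  gcongr

lemma le_sSup_rpow_of_exists_pos {Ω : Set R2} (hop : IsOpen Ω) (hbdd : Bornology.IsBounded Ω)
    {lam : ℝ}
    (hpoincare : ∀ v : R2 → ℝ, (∃ L : NNReal, LipschitzWith L v) →
      (∀ x ∉ Ω, v x = 0) → lam * ∫ x, v x ^ 2 ≤ ∫ x, ‖gradient v x‖ ^ 2)
    {p : ℝ} (hp : 1 < p) {u : R2 → ℝ} (hu : ContDiffOn ℝ 2 u Ω)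
    (hcont : ContinuousOn u (closure Ω)) (hbd : ∀ x ∈ frontier Ω, u x = 0)
    (heq : ∀ x ∈ Ω, -lap u x = |u x| ^ (p - 1) * u x) (hpos : ∃ x ∈ Ω, 0 < u x) :
    lam ≤ sSup (u '' Ω) ^ (p - 1) := by
  obtain ⟨x₀, hx₀, hux₀⟩ := hpos
  have hba : BddAbove (u '' Ω) :=
    (hbdd.isCompact_closure.bddAbove_image hcont).mono (image_mono subset_closure)
  set M := sSup (u '' Ω) with hMdef
  have huM : ∀ x ∈ Ω, u x ≤ M := fun x hx => le_csSup hba (mem_image_of_mem u hx)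
  have hM : 0 ≤ M := hux₀.le.trans (huM x₀ hx₀)
  have key := fun {ε : ℝ} (hε : 0 < ε) =>
    poincare_mul_integral_sq_le hop hbdd hpoincare hp hu hcont hbd heq hM huM hε
  set A := M ^ (p - 1) with hAdef
  have hA : 0 ≤ A := Real.rpow_nonneg hM _
  set B := volume.real Ω * M with hBdef
  have hB : 0 ≤ B := by positivity
  have hsq : ∀ {v : R2 → ℝ}, Continuous v → HasCompactSupport v → Integrable fun x => v x ^ 2 := by
    intro v hv hvc
    simp_rw [sq]
    exact (hv.mul hv).integrable_of_hasCompactSupport hvc.mul_right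
  obtain ⟨v₀, hv₀c, hv₀s, hv₀0, hv₀u, -⟩ := key (half_pos hux₀)
  have hc : 0 < ∫ x, v₀ x ^ 2 := by
    refine (hv₀c.pow 2).integral_pos_of_hasCompactSupport_nonneg_nonzero (x := x₀) ?_ ?_ ?_
    · simp_rw [sq]
      exact hv₀s.mul_right
    · exact fun x => sq_nonneg _
    · have : 0 < v₀ x₀ := by
        rw [hv₀u x₀ hx₀]
        exact lt_max_of_lt_left (by linarith)
      positivity
  set c := ∫ x, v₀ x ^ 2 with hcdef
  by_contra! hlt
  have hd : 0 < (lam - A) * c := mul_pos (by linarith) hc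
  have hAB : 0 < A * B + 1 := by positivity
  obtain ⟨ε, hε, hε1, hε2⟩ : ∃ ε > 0, ε ≤ u x₀ / 2 ∧ ε * (A * B + 1) ≤ (lam - A) * c :=
    ⟨min (u x₀ / 2) ((lam - A) * c / (A * B + 1)), lt_min (half_pos hux₀) (div_pos hd hAB),
      min_le_left _ _, (le_div_iff₀ hAB).1 (min_le_right _ _)⟩
  obtain ⟨v, hvc, hvs, hv0, hvu, hv⟩ := key hε
  have hcv : c ≤ ∫ x, v x ^ 2 := by
    refine integral_mono (hsq hv₀c hv₀s) (hsq hvc hvs) fun x => ?_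
    by_cases hx : x ∈ Ω
    · simp only [hv₀u x hx, hvu x hx]
      gcongr
    · simp [hv₀0 x hx, hv0 x hx]
  have : (lam - A) * c ≤ (lam - A) * ∫ x, v x ^ 2 :=
    mul_le_mul_of_nonneg_left hcv (by linarith)
  nlinarith

theorem stmt4
    (Ω : Set R2) (hne : Ω.Nonempty) (hop : IsOpen Ω)
    (hbdd : Bornology.IsBounded Ω) (hconn : IsConnected Ω) (hsm : SmoothBoundary Ω)
    (lam : ℝ) (hlam : 0 < lam)
    (hpoincare : ∀ v : R2 → ℝ, (∃ L : NNReal, LipschitzWith L v) →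
      (∀ x ∉ Ω, v x = 0) → lam * ∫ x, v x ^ 2 ≤ ∫ x, ‖gradient v x‖ ^ 2)
    (p : ℝ) (hp : 1 < p) (up : R2 → ℝ)
    (hsol : IsSolution Ω p up) (hnod : IsNodal Ω up) :
    lam ≤ sSup (up '' Ω) ^ (p - 1) ∧ lam ≤ (-sInf (up '' Ω)) ^ (p - 1) := by
  obtain ⟨hu, hu1, heq, hbd⟩ := hsol
  obtain ⟨hpos, hneg⟩ := hnod
  refine ⟨le_sSup_rpow_of_exists_pos hop hbdd hpoincare hp hu hu1.continuousOn hbd heq hpos, ?_⟩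
  have hS : -sInf (up '' Ω) = sSup ((fun x => -up x) '' Ω) := by
    rw [Real.sInf_def, neg_neg, ← image_neg_eq_neg, image_image]
  rw [hS]
  refine le_sSup_rpow_of_exists_pos hop hbdd hpoincare hp hu.neg hu1.continuousOn.neg
    (fun x hx => by simp [hbd x hx]) (fun x hx => ?_) ?_
  · rw [lap_neg, abs_neg, mul_neg, ← heq x hx]
  · obtain ⟨x, hx, h⟩ := hneg
    exact ⟨x, hx, neg_pos.2 h⟩
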